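/- Let J₀ > 0, β > 0 and J ∈ ℝ with −J₀ < J < J₀, and suppose Δ = (C₃−C₁)/C₂ > 0 (note that −J₀ < J < J₀ implies C₂ > 0). Then 0 < C₁ < C₃, and consequently |C₁/C₃ − 1/2| < 1/2. (This contraction estimate is the key step in showing the states φ₁ and φ₂ are not quasi-equivalent.) -/

import Mathlib

noncomputable section

def C₁ (J₀ J β : ℝ) : ℝ :=
  (1/4) * (Real.exp (4 * J₀ * β) + 1) + (1/2) * Real.exp (2 * J₀ * β) * Real.cosh (2 * J * β)

def C₂ (J₀ J β : ℝ) : ℝ :=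
  (1/4) * (Real.exp (4 * J₀ * β) + 1) - (1/2) * Real.exp (2 * J₀ * β) * Real.cosh (2 * J * β)

def C₃ (J₀ J β : ℝ) : ℝ := (1/2) * (Real.exp (4 * J₀ * β) - 1)

def Δ (J₀ J β : ℝ) : ℝ := (C₃ J₀ J β - C₁ J₀ J β) / C₂ J₀ J β

theorem four_mul_C₂ (J₀ J β : ℝ) :
    4 * C₂ J₀ J β =
      (Real.exp (2 * β * (J₀ - J)) - 1) * (Real.exp (2 * β * (J₀ + J)) - 1) := by
  have h₁ : Real.exp (4 * J₀ * β) =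
      Real.exp (2 * β * (J₀ - J)) * Real.exp (2 * β * (J₀ + J)) := by
    rw [← Real.exp_add]; ring_nf
  have h₂ : Real.exp (2 * β * (J₀ - J)) = Real.exp (2 * J₀ * β) * Real.exp (-(2 * J * β)) := by
    rw [← Real.exp_add]; ring_nf
  have h₃ : Real.exp (2 * β * (J₀ + J)) = Real.exp (2 * J₀ * β) * Real.exp (2 * J * β) := by
    rw [← Real.exp_add]; ring_nf
  rw [C₂, Real.cosh_eq]
  linear_combination h₁ + h₂ + h₃

theorem C₂_pos {J₀ J β : ℝ} (hβ : 0 < β) (hJ : -J₀ < J ∧ J < J₀) : 0 < C₂ J₀ J β := by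
  have h₁ : 0 < 2 * β * (J₀ - J) := mul_pos (by linarith) (by linarith [hJ.2])
  have h₂ : 0 < 2 * β * (J₀ + J) := mul_pos (by linarith) (by linarith [hJ.1])
  have h := mul_pos (sub_pos.2 (Real.one_lt_exp_iff.2 h₁)) (sub_pos.2 (Real.one_lt_exp_iff.2 h₂))
  linarith [four_mul_C₂ J₀ J β]

theorem C₁_pos (J₀ J β : ℝ) : 0 < C₁ J₀ J β := by
  have := Real.cosh_pos (2 * J * β)
  unfold C₁
  positivity

theorem contraction_estimate (J₀ J β : ℝ) (hJ₀ : 0 < J₀) (hβ : 0 < β)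
    (hJ : -J₀ < J ∧ J < J₀) (hΔ : 0 < Δ J₀ J β) :
    0 < C₂ J₀ J β ∧ 0 < C₁ J₀ J β ∧ C₁ J₀ J β < C₃ J₀ J β ∧
      |C₁ J₀ J β / C₃ J₀ J β - 1/2| < 1/2 := by
  have h₂ := C₂_pos hβ hJ
  have h₁ := C₁_pos J₀ J β
  have h₁₃ : C₁ J₀ J β < C₃ J₀ J β := sub_pos.1 ((div_pos_iff_of_pos_right h₂).1 hΔ)
  have h₃ := h₁.trans h₁₃
  refine ⟨h₂, h₁, h₁₃, abs_lt.2 ⟨?_, ?_⟩⟩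
  · linarith [div_pos h₁ h₃]
  · linarith [(div_lt_one h₃).2 h₁₃]
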